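/- Let (x_j)_{j∈J} be a frame of a finite dimensional Hilbert space H with frame bounds B ≥ A > 0 which does C-stable phase retrieval. Let ε > 0 satisfy ε < 2⁻⁴ C⁻⁴ B⁻¹ and let (y_j)_{j∈J} be a family of vectors in H such that Σ_{j∈J} ‖x_j − y_j‖² < ε. Then (y_j)_{j∈J} is a frame of H with upper frame bound B(1 + √(ε/B))² and lower frame bound A(1 − √(ε/A))², and (y_j)_{j∈J} does C(1 − 4C²√(εB))^{−1/2}-stable phase retrieval. -/

import Mathlib

open scoped ComplexInnerProductSpace

/-- A family `(x j)` in a Hilbert space `H` does `C`-stable phase retrieval if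
`min_{|λ|=1} ‖u - λ v‖ ≤ C (∑ⱼ ||⟨u,xⱼ⟩| - |⟨v,xⱼ⟩||²)^{1/2}` for all `u, v ∈ H`. -/
def DoesStablePhaseRetrieval {H : Type*} [NormedAddCommGroup H] [InnerProductSpace ℂ H]
    {J : Type*} (x : J → H) (C : ℝ) : Prop :=
  ∀ u v : H,
    (⨅ lam : {c : ℂ // ‖c‖ = 1}, ‖u - (lam : ℂ) • v‖) ≤
      C * Real.sqrt (∑' j, (‖⟪u, x j⟫‖ - ‖⟪v, x j⟫‖) ^ 2)

lemma le_of_sq_le_sq_aux {a b : ℝ} (h : a ^ 2 ≤ b ^ 2) (hb : 0 ≤ b) : a ≤ b :=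
  abs_le_of_sq_le_sq' h hb |>.2

lemma pt_upper (p q d k : ℝ) (hk : 0 < k) (h : |p - q| ≤ d) :
    q ^ 2 ≤ (1 + k) * p ^ 2 + (1 + 1 / k) * d ^ 2 := by
  have h2 : (q - p) ^ 2 ≤ d ^ 2 := by
    rw [← sq_abs (q - p), abs_sub_comm]
    exact pow_le_pow_left₀ (abs_nonneg _) h 2
  have h3 : q ^ 2 ≤ (1 + k) * p ^ 2 + (1 + 1 / k) * (q - p) ^ 2 := by
    have : (1 + k) * p ^ 2 + (1 + 1 / k) * (q - p) ^ 2 - q ^ 2 = (k * p - (q - p)) ^ 2 / k := by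
      field_simp; ring
    have h4 : 0 ≤ (k * p - (q - p)) ^ 2 / k := by positivity
    linarith
  have h5 : (1 + 1 / k) * (q - p) ^ 2 ≤ (1 + 1 / k) * d ^ 2 := by gcongr
  linarith

lemma pt_lower (p q d k : ℝ) (hk : 0 < k) (hk1 : k ≤ 1) (h : |p - q| ≤ d) :
    (1 - k) * p ^ 2 - (1 / k - 1) * d ^ 2 ≤ q ^ 2 := by
  have h2 : (q - p) ^ 2 ≤ d ^ 2 := by
    rw [← sq_abs (q - p), abs_sub_comm]
    exact pow_le_pow_left₀ (abs_nonneg _) h 2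
  have h3 : (1 - k) * p ^ 2 - (1 / k - 1) * (q - p) ^ 2 ≤ q ^ 2 := by
    have : q ^ 2 - ((1 - k) * p ^ 2 - (1 / k - 1) * (q - p) ^ 2) = (k * p + (q - p)) ^ 2 / k := by
      field_simp; ring
    have h4 : 0 ≤ (k * p + (q - p)) ^ 2 / k := by positivity
    linarith
  have h6 : 0 ≤ 1 / k - 1 := by
    rw [sub_nonneg, le_div_iff₀ hk]; linarith
  have h5 : (1 / k - 1) * (q - p) ^ 2 ≤ (1 / k - 1) * d ^ 2 := by gcongr
  linarith

lemma sum_q {J : Type*} (p q d : J → ℝ) (h : ∀ j, |p j - q j| ≤ d j)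
    (hp : Summable fun j => p j ^ 2) (hd : Summable fun j => d j ^ 2) :
    Summable fun j => q j ^ 2 := by
  refine Summable.of_nonneg_of_le (fun j => sq_nonneg _)
    (fun j => pt_upper (p j) (q j) (d j) 1 one_pos (h j)) ?_
  exact (hp.mul_left _).add (hd.mul_left _)

lemma sum_upper {J : Type*} (p q d : J → ℝ) (h : ∀ j, |p j - q j| ≤ d j)
    (hp : Summable fun j => p j ^ 2) (hd : Summable fun j => d j ^ 2) (k : ℝ) (hk : 0 < k) :
    ∑' j, q j ^ 2 ≤ (1 + k) * ∑' j, p j ^ 2 + (1 + 1 / k) * ∑' j, d j ^ 2 := by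
  rw [← tsum_mul_left, ← tsum_mul_left, ← (hp.mul_left _).tsum_add (hd.mul_left _)]
  exact (sum_q p q d h hp hd).tsum_le_tsum (fun j => pt_upper (p j) (q j) (d j) k hk (h j))
    ((hp.mul_left _).add (hd.mul_left _))

lemma sum_lower {J : Type*} (p q d : J → ℝ) (h : ∀ j, |p j - q j| ≤ d j)
    (hp : Summable fun j => p j ^ 2) (hd : Summable fun j => d j ^ 2) (k : ℝ) (hk : 0 < k)
    (hk1 : k ≤ 1) :
    (1 - k) * ∑' j, p j ^ 2 - (1 / k - 1) * ∑' j, d j ^ 2 ≤ ∑' j, q j ^ 2 := by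
  rw [← tsum_mul_left, ← tsum_mul_left, ← (hp.mul_left _).tsum_sub (hd.mul_left _)]
  exact ((hp.mul_left _).sub (hd.mul_left _)).tsum_le_tsum
    (fun j => pt_lower (p j) (q j) (d j) k hk hk1 (h j)) (sum_q p q d h hp hd)

lemma cplx_id (a b : ℂ) :
    (‖a + b‖ - ‖a - b‖) ^ 2 = 2 * ‖a‖ ^ 2 + 2 * ‖b‖ ^ 2 - 2 * ‖a ^ 2 - b ^ 2‖ := by
  have h1 : ‖a ^ 2 - b ^ 2‖ = ‖a + b‖ * ‖a - b‖ := by rw [← norm_mul]; congr 1; ring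
  have h2 := parallelogram_law_with_norm ℝ a b
  rw [h1]; nlinarith

lemma cplx_mono (a b : ℂ) (t : ℝ) (h0 : 0 ≤ t) (h1 : t ≤ 1) :
    (‖a + t * b‖ - ‖a - t * b‖) ^ 2 ≤ (‖a + b‖ - ‖a - b‖) ^ 2 := by
  rw [cplx_id, cplx_id]
  have h2 : ‖a ^ 2 - b ^ 2‖ ≤ ‖a ^ 2 - (t * b) ^ 2‖ + (1 - t ^ 2) * ‖b‖ ^ 2 := by
    have e : a ^ 2 - b ^ 2 = (a ^ 2 - (t * b) ^ 2) - ((1 - t ^ 2 : ℝ) : ℂ) * b ^ 2 := by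
      push_cast; ring
    rw [e]
    refine (norm_sub_le _ _).trans ?_
    rw [norm_mul, norm_pow, Complex.norm_real, Real.norm_of_nonneg (by nlinarith)]
  have h3 : ‖(t : ℂ) * b‖ = t * ‖b‖ := by
    rw [norm_mul, Complex.norm_real, Real.norm_of_nonneg h0]
  rw [h3]; nlinarith

lemma exists_phase {H : Type*} [NormedAddCommGroup H] [InnerProductSpace ℂ H] (u v : H) :
    ∃ c : ℂ, ‖c‖ = 1 ∧ ⟪u, c • v⟫ = ((‖⟪u, v⟫‖ : ℝ) : ℂ) := by
  by_cases h : ⟪u, v⟫ = 0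
  · exact ⟨1, by simp, by simp [h]⟩
  · have hn : ((‖⟪u, v⟫‖ : ℝ) : ℂ) ≠ 0 := by simpa using h
    refine ⟨((‖⟪u, v⟫‖ : ℝ) : ℂ) / ⟪u, v⟫, ?_, ?_⟩
    · rw [norm_div, Complex.norm_real, norm_norm, div_self (by simpa using h)]
    · rw [inner_smul_right, div_mul_cancel₀ _ h]

lemma norm_sub_orth {H : Type*} [NormedAddCommGroup H] [InnerProductSpace ℂ H] (U V : H)
    (h : ⟪U, V⟫ = 0) (c : ℂ) (hc : ‖c‖ = 1) : ‖U - c • V‖ ^ 2 = ‖U‖ ^ 2 + ‖V‖ ^ 2 := by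
  rw [@norm_sub_sq ℂ, inner_smul_right, h, norm_smul, hc]; simp


set_option maxHeartbeats 2000000

/-- **Perturbation theorem for stable phase retrieval.** If `(x j)` is a frame of a finite
dimensional Hilbert space `H` with frame bounds `B ≥ A > 0` doing `C`-stable phase retrieval,
`0 < ε < 2⁻⁴C⁻⁴B⁻¹`, and `∑ ‖x j - y j‖² < ε`, then `(y j)` is a frame with upper frame bound
`B(1+√(ε/B))²` and lower frame bound `A(1-√(ε/A))²` which does
`C(1-4C²√(εB))^{-1/2}`-stable phase retrieval. -/
theorem stmt_1 {H : Type*} [NormedAddCommGroup H] [InnerProductSpace ℂ H]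
    [FiniteDimensional ℂ H] {J : Type*} (x y : J → H) (A B C ε : ℝ)
    (hA : 0 < A) (hAB : A ≤ B)
    (hx_summable : ∀ u : H, Summable fun j => ‖⟪u, x j⟫‖ ^ 2)
    (hx_frame : ∀ u : H,
      A * ‖u‖ ^ 2 ≤ ∑' j, ‖⟪u, x j⟫‖ ^ 2 ∧ ∑' j, ‖⟪u, x j⟫‖ ^ 2 ≤ B * ‖u‖ ^ 2)
    (hC : 0 < C) (hx_spr : DoesStablePhaseRetrieval x C)
    (hε : 0 < ε) (hεB : ε < 2⁻¹ ^ 4 * C⁻¹ ^ 4 * B⁻¹)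
    (hpert_summable : Summable fun j => ‖x j - y j‖ ^ 2)
    (hpert : ∑' j, ‖x j - y j‖ ^ 2 < ε) :
    (∀ u : H, Summable fun j => ‖⟪u, y j⟫‖ ^ 2) ∧
      (∀ u : H,
        A * (1 - Real.sqrt (ε / A)) ^ 2 * ‖u‖ ^ 2 ≤ ∑' j, ‖⟪u, y j⟫‖ ^ 2 ∧
          ∑' j, ‖⟪u, y j⟫‖ ^ 2 ≤ B * (1 + Real.sqrt (ε / B)) ^ 2 * ‖u‖ ^ 2) ∧
      DoesStablePhaseRetrieval y
        (C * (1 - 4 * C ^ 2 * Real.sqrt (ε * B)) ^ (-(1 / 2 : ℝ))) := by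
  have hB : 0 < B := hA.trans_le hAB
  have hεB' : ε * (16 * C ^ 4 * B) < 1 := by
    have h := mul_lt_mul_of_pos_right hεB (show 0 < 16 * C ^ 4 * B by positivity)
    have e : (2⁻¹ ^ 4 * C⁻¹ ^ 4 * B⁻¹) * (16 * C ^ 4 * B) = 1 := by field_simp; norm_num
    linarith
  have hnonneg : ∀ w : H, Summable fun j => (‖x j - y j‖ * ‖w‖) ^ 2 := fun w => by
    simp_rw [mul_pow]; exact hpert_summable.mul_right _
  have hdsum : ∀ t : ℝ, Summable fun j => (‖x j - y j‖ * t) ^ 2 := fun t => by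
    simp_rw [mul_pow]; exact hpert_summable.mul_right _
  have hdle : ∀ t : ℝ, ∑' j, (‖x j - y j‖ * t) ^ 2 ≤ ε * t ^ 2 := fun t => by
    simp_rw [mul_pow]; rw [tsum_mul_right]
    exact mul_le_mul_of_nonneg_right hpert.le (sq_nonneg _)
  have hpt : ∀ (w : H) (j : J), |‖⟪w, x j⟫‖ - ‖⟪w, y j⟫‖| ≤ ‖x j - y j‖ * ‖w‖ := fun w j => by
    refine (abs_norm_sub_norm_le _ _).trans ?_
    rw [← inner_sub_right, mul_comm]
    exact norm_inner_le_norm _ _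
  -- the lower frame bound coming from stability
  have hlowC : ∀ w : H, ‖w‖ ^ 2 ≤ C ^ 2 * ∑' j, ‖⟪w, x j⟫‖ ^ 2 := fun w => by
    have h := hx_spr w 0
    have : Nonempty {c : ℂ // ‖c‖ = 1} := ⟨⟨1, by simp⟩⟩
    simp only [smul_zero, sub_zero, inner_zero_left, norm_zero, ciInf_const] at h
    have h2 := pow_le_pow_left₀ (norm_nonneg w) h 2
    rwa [mul_pow, Real.sq_sqrt (tsum_nonneg fun j => sq_nonneg _)] at h2
  have hCB : ∀ w : H, w ≠ 0 → 1 ≤ C ^ 2 * B := fun w hw => by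
    have h1 := hlowC w
    have h2 := mul_le_mul_of_nonneg_left (hx_frame w).2 (sq_nonneg C)
    have h3 : 0 < ‖w‖ ^ 2 := by have := norm_pos_iff.2 hw; positivity
    by_contra hcon
    push Not at hcon
    nlinarith
  have hysum : ∀ u : H, Summable fun j => ‖⟪u, y j⟫‖ ^ 2 := fun u =>
    sum_q _ _ _ (hpt u) (hx_summable u) (hdsum ‖u‖)
  refine ⟨hysum, fun u => ⟨?_, ?_⟩, ?_⟩
  · by_cases hu : u = 0
    · simp [hu]
    have hun : 0 < ‖u‖ ^ 2 := by have := norm_pos_iff.2 hu; positivity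
    set r := Real.sqrt (ε / A) with hr
    have hr0 : 0 < r := Real.sqrt_pos.2 (by positivity)
    have hr2 : r ^ 2 = ε / A := Real.sq_sqrt (by positivity)
    have hAr : ε = A * r ^ 2 := by rw [hr2]; field_simp
    by_cases hr1 : r ≤ 1
    · have h := sum_lower _ _ _ (hpt u) (hx_summable u) (hdsum ‖u‖) r hr0 hr1
      refine le_trans ?_ h
      have h1 := mul_le_mul_of_nonneg_left (hx_frame u).1 (sub_nonneg.2 hr1)
      have h6 : 0 ≤ 1 / r - 1 := by
        rw [sub_nonneg, le_div_iff₀ hr0]; linarith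
      have h2 := mul_le_mul_of_nonneg_left (hdle ‖u‖) h6
      have h3 : (1 / r - 1) * (ε * ‖u‖ ^ 2) = (r - r ^ 2) * A * ‖u‖ ^ 2 := by
        rw [hAr]; field_simp
      rw [h3] at h2
      nlinarith
    · push Not at hr1
      have h := sum_lower _ _ _ (hpt u) (hx_summable u) (hdsum ‖u‖) (1 / 4) (by norm_num)
        (by norm_num)
      refine le_trans ?_ h
      have h1 : A * (1 - r) ^ 2 ≤ ε := by rw [hAr]; nlinarith
      have h2 := hdle ‖u‖
      have h3 := hlowC u
      have h4 := hCB u hu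
      have h5 : 16 * ε * C ^ 2 ≤ 1 := by
        have : 16 * ε * C ^ 2 * 1 ≤ 16 * ε * C ^ 2 * (C ^ 2 * B) := by gcongr
        nlinarith
      have h7 : 16 * ε * ‖u‖ ^ 2 ≤ ∑' j, ‖⟪u, x j⟫‖ ^ 2 := by
        have hS : 0 ≤ ∑' j, ‖⟪u, x j⟫‖ ^ 2 := tsum_nonneg fun j => sq_nonneg _
        calc 16 * ε * ‖u‖ ^ 2 ≤ 16 * ε * (C ^ 2 * ∑' j, ‖⟪u, x j⟫‖ ^ 2) := by gcongr
          _ = (16 * ε * C ^ 2) * ∑' j, ‖⟪u, x j⟫‖ ^ 2 := by ring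
          _ ≤ 1 * ∑' j, ‖⟪u, x j⟫‖ ^ 2 := by gcongr
          _ = _ := one_mul _
      have h8 : A * (1 - r) ^ 2 * ‖u‖ ^ 2 ≤ ε * ‖u‖ ^ 2 := by gcongr
      have h9 : 0 < ε * ‖u‖ ^ 2 := by positivity
      norm_num
      linarith
  · set r := Real.sqrt (ε / B) with hr
    have hr0 : 0 < r := Real.sqrt_pos.2 (by positivity)
    have hr2 : r ^ 2 = ε / B := Real.sq_sqrt (by positivity)
    have hAr : ε = B * r ^ 2 := by rw [hr2]; field_simp
    have h := sum_upper _ _ _ (hpt u) (hx_summable u) (hdsum ‖u‖) r hr0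
    refine h.trans ?_
    have h1 := mul_le_mul_of_nonneg_left (hx_frame u).2 (show 0 ≤ 1 + r by positivity)
    have h2 := mul_le_mul_of_nonneg_left (hdle ‖u‖) (show 0 ≤ 1 + 1 / r by positivity)
    have h3 : (1 + 1 / r) * (ε * ‖u‖ ^ 2) = (r + r ^ 2) * B * ‖u‖ ^ 2 := by
      rw [hAr]; field_simp; ring
    rw [h3] at h2
    nlinarith
  · intro u v
    set r := Real.sqrt (ε * B) with hr
    have hr0 : 0 < r := Real.sqrt_pos.2 (by positivity)
    have hr2 : r ^ 2 = ε * B := Real.sq_sqrt (by positivity)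
    have hrC : 4 * C ^ 2 * r < 1 := by
      have : (4 * C ^ 2 * r) ^ 2 < 1 := by
        have e : (4 * C ^ 2 * r) ^ 2 = 16 * C ^ 4 * r ^ 2 := by ring
        rw [e, hr2]; linarith
      nlinarith
    set m := 1 - 4 * C ^ 2 * r with hm
    have hm0 : 0 < m := by linarith
    obtain ⟨c, hc, hcv⟩ := exists_phase u v
    set v' := c • v with hv'
    have hvn : ∀ j, ‖⟪v', y j⟫‖ = ‖⟪v, y j⟫‖ := fun j => by
      rw [hv', inner_smul_left, norm_mul]; simp [hc]
    set S := ∑' j, (‖⟪u, y j⟫‖ - ‖⟪v, y j⟫‖) ^ 2 with hS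
    have hS0 : 0 ≤ S := tsum_nonneg fun j => sq_nonneg _
    have hbdd : ∀ a b : H, BddBelow (Set.range fun lam : {c : ℂ // ‖c‖ = 1} =>
        ‖a - (lam : ℂ) • b‖) := fun a b =>
      ⟨0, by rintro _ ⟨l, rfl⟩; exact norm_nonneg _⟩
    refine (ciInf_le (hbdd u v) ⟨c, hc⟩).trans ?_
    change ‖u - v'‖ ≤ _
    set a := u - v' with ha
    set b := u + v' with hb
    have hmpow : 0 < m ^ (-(1 / 2 : ℝ)) := Real.rpow_pos_of_pos hm0 _
    have hmsq : (m ^ (-(1 / 2 : ℝ))) ^ 2 * m = 1 := by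
      rw [← Real.rpow_natCast, ← Real.rpow_mul hm0.le]
      norm_num
      rw [Real.rpow_neg_one, inv_mul_cancel₀ hm0.ne']
    suffices hmain : ‖a‖ ^ 2 * m ≤ C ^ 2 * S by
      refine le_of_sq_le_sq_aux ?_ (by positivity)
      rw [mul_pow, mul_pow, Real.sq_sqrt hS0]
      have := mul_le_mul_of_nonneg_left hmain (sq_nonneg (m ^ (-(1 / 2 : ℝ))))
      calc ‖a‖ ^ 2 = ‖a‖ ^ 2 * ((m ^ (-(1 / 2 : ℝ))) ^ 2 * m) := by rw [hmsq, mul_one]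
        _ = (m ^ (-(1 / 2 : ℝ))) ^ 2 * (‖a‖ ^ 2 * m) := by ring
        _ ≤ _ := this
        _ = _ := by ring
    by_cases ha0 : a = 0
    · rw [ha0]; simp; positivity
    have hapos : 0 < ‖a‖ := norm_pos_iff.2 ha0
    have hvu : ⟪v', u⟫ = ((‖⟪u, v⟫‖ : ℝ) : ℂ) := by
      rw [← inner_conj_symm, hcv, Complex.conj_ofReal]
    have hab : ‖a‖ ≤ ‖b‖ := by
      refine le_of_sq_le_sq_aux ?_ (norm_nonneg _)
      rw [ha, hb, @norm_sub_sq ℂ, @norm_add_sq ℂ, hcv]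
      have : 0 ≤ ‖⟪u, v⟫‖ := norm_nonneg _
      simp only [RCLike.re_to_complex, Complex.ofReal_re]
      linarith
    have hbpos : 0 < ‖b‖ := hapos.trans_le hab
    set t := ‖a‖ / ‖b‖ with ht
    have ht0 : 0 ≤ t := by positivity
    have ht1 : t ≤ 1 := by rw [ht, div_le_one hbpos]; exact hab
    set b' := (t : ℂ) • b with hb'
    have hb'n : ‖b'‖ = ‖a‖ := by
      rw [hb', norm_smul, Complex.norm_real, Real.norm_of_nonneg ht0, ht]
      field_simp
    have hcomm : ⟪a, b'⟫ = ⟪b', a⟫ := by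
      rw [hb', inner_smul_left, inner_smul_right, Complex.conj_ofReal]
      congr 1
      rw [ha, hb]
      simp only [inner_sub_left, inner_add_right, inner_sub_right, inner_add_left, hcv, hvu]
      ring
    set U := a + b' with hU
    set V := a - b' with hV
    have horth : ⟪U, V⟫ = 0 := by
      rw [hU, hV, inner_add_left, inner_sub_right a a b', inner_sub_right b' a b', hcomm,
        inner_self_eq_norm_sq_to_K, inner_self_eq_norm_sq_to_K, hb'n]
      ring
    have hUV : ‖U‖ ^ 2 + ‖V‖ ^ 2 = 4 * ‖a‖ ^ 2 := by
      have := parallelogram_law_with_norm ℂ a b'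
      rw [hb'n] at this
      rw [hU, hV]; linarith
    have hUle : ‖U‖ ≤ 2 * ‖a‖ := by
      refine (norm_add_le _ _).trans ?_
      rw [hb'n]; linarith
    have hVle : ‖V‖ ≤ 2 * ‖a‖ := by
      refine (norm_sub_le _ _).trans ?_
      rw [hb'n]; linarith
    let p : J → ℝ := fun j => ‖⟪U, x j⟫‖ - ‖⟪V, x j⟫‖
    let q : J → ℝ := fun j => ‖⟪U, y j⟫‖ - ‖⟪V, y j⟫‖
    have hps : Summable fun j => p j ^ 2 := by
      refine Summable.of_nonneg_of_le (fun j => sq_nonneg _) (fun j => ?_)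
        ((hx_summable U).add (hx_summable V))
      have : 0 ≤ ‖⟪U, x j⟫‖ * ‖⟪V, x j⟫‖ := by positivity
      simp only [p]; nlinarith
    have hpB : ∑' j, p j ^ 2 ≤ 4 * B * ‖a‖ ^ 2 := by
      have h1 : ∑' j, p j ^ 2 ≤ ∑' j, (‖⟪U, x j⟫‖ ^ 2 + ‖⟪V, x j⟫‖ ^ 2) := by
        refine hps.tsum_le_tsum (fun j => ?_) ((hx_summable U).add (hx_summable V))
        have : 0 ≤ ‖⟪U, x j⟫‖ * ‖⟪V, x j⟫‖ := by positivity
        simp only [p]; nlinarith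
      rw [(hx_summable U).tsum_add (hx_summable V)] at h1
      have h2 := (hx_frame U).2
      have h3 := (hx_frame V).2
      have h4 : B * ‖U‖ ^ 2 + B * ‖V‖ ^ 2 = 4 * B * ‖a‖ ^ 2 := by
        rw [← mul_add, hUV]; ring
      linarith
    have hpC : 4 * ‖a‖ ^ 2 ≤ C ^ 2 * ∑' j, p j ^ 2 := by
      have h := hx_spr U V
      have : Nonempty {c : ℂ // ‖c‖ = 1} := ⟨⟨1, by simp⟩⟩
      have h1 : 2 * ‖a‖ ≤ ⨅ lam : {c : ℂ // ‖c‖ = 1}, ‖U - (lam : ℂ) • V‖ := by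
        refine le_ciInf fun l => ?_
        refine le_of_sq_le_sq_aux ?_ (norm_nonneg _)
        rw [norm_sub_orth U V horth l l.2, hUV]
        exact le_of_eq (by ring)
      have h2 := pow_le_pow_left₀ (by positivity) (h1.trans h) 2
      rw [mul_pow, mul_pow, Real.sq_sqrt (tsum_nonneg fun j => sq_nonneg _)] at h2
      linarith
    have hpq : ∀ j, |p j - q j| ≤ ‖x j - y j‖ * (4 * ‖a‖) := fun j => by
      have h1 := abs_le.1 (hpt U j)
      have h2 := abs_le.1 (hpt V j)
      have h3 := mul_le_mul_of_nonneg_left hUle (norm_nonneg (x j - y j))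
      have h4 := mul_le_mul_of_nonneg_left hVle (norm_nonneg (x j - y j))
      simp only [p, q]
      rw [abs_le]; constructor <;> linarith [h1.1, h1.2, h2.1, h2.2]
    set k := 2 * r / B with hk
    have hk0 : 0 < k := by positivity
    have hk1 : k ≤ 1 := by
      rw [hk, div_le_one hB]
      have h4 := hCB a ha0
      nlinarith
    have hlow := sum_lower p q _ hpq hps (hdsum (4 * ‖a‖)) k hk0 hk1
    have hd := hdle (4 * ‖a‖)
    have h6 : 0 ≤ 1 / k - 1 := by
      rw [sub_nonneg, le_div_iff₀ hk0]; linarith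
    have hd2 := mul_le_mul_of_nonneg_left hd h6
    have hε' : ε = r ^ 2 / B := by rw [hr2]; field_simp
    have e1 : 1 / k * (ε * (4 * ‖a‖) ^ 2) = 8 * r * ‖a‖ ^ 2 := by
      rw [hε', hk]; field_simp; ring
    have e2 : k * (4 * B * ‖a‖ ^ 2) = 8 * r * ‖a‖ ^ 2 := by
      rw [hk]; field_simp; ring
    have hkp := mul_le_mul_of_nonneg_left hpB hk0.le
    have hpos : 0 ≤ ε * (4 * ‖a‖) ^ 2 := by positivity
    have hq1 : ∑' j, p j ^ 2 - 16 * r * ‖a‖ ^ 2 ≤ ∑' j, q j ^ 2 := by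
      linarith
    have hysum2 : Summable fun j => (‖⟪u, y j⟫‖ - ‖⟪v, y j⟫‖) ^ 2 := by
      refine Summable.of_nonneg_of_le (fun j => sq_nonneg _) (fun j => ?_)
        ((hysum u).add (hysum v))
      have : 0 ≤ ‖⟪u, y j⟫‖ * ‖⟪v, y j⟫‖ := by positivity
      nlinarith
    have hqs : Summable fun j => q j ^ 2 := sum_q p q _ hpq hps (hdsum (4 * ‖a‖))
    have hqS : ∑' j, q j ^ 2 ≤ 4 * S := by
      rw [hS, ← tsum_mul_left]
      refine hqs.tsum_le_tsum (fun j => ?_) (hysum2.mul_left _)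
      have h1 := cplx_mono ⟪a, y j⟫ ⟪b, y j⟫ t ht0 ht1
      have e3 : ⟪U, y j⟫ = ⟪a, y j⟫ + t * ⟪b, y j⟫ := by
        rw [hU, hb', inner_add_left, inner_smul_left, Complex.conj_ofReal]
      have e4 : ⟪V, y j⟫ = ⟪a, y j⟫ - t * ⟪b, y j⟫ := by
        rw [hV, hb', inner_sub_left, inner_smul_left, Complex.conj_ofReal]
      have e5 : ‖⟪a, y j⟫ + ⟪b, y j⟫‖ = 2 * ‖⟪u, y j⟫‖ := by
        have : ⟪a, y j⟫ + ⟪b, y j⟫ = 2 * ⟪u, y j⟫ := by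
          rw [ha, hb, inner_sub_left, inner_add_left]; ring
        rw [this, norm_mul]; simp
      have e6 : ‖⟪a, y j⟫ - ⟪b, y j⟫‖ = 2 * ‖⟪v, y j⟫‖ := by
        have : ⟪a, y j⟫ - ⟪b, y j⟫ = -2 * ⟪v', y j⟫ := by
          rw [ha, hb, inner_sub_left, inner_add_left]; ring
        rw [this, norm_mul, hvn]; simp
      rw [e5, e6, ← e3, ← e4] at h1
      simp only [q]
      linarith
    have hfin := mul_le_mul_of_nonneg_left (hq1.trans hqS) (sq_nonneg C)
    rw [hm]
    linarith
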